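/- The element (0,⟨⟩) does not belong to H; in particular, H is a proper subgroup of G. -/

import Mathlib

/-- Generators of the group `K`: tree vertices `(n,τ)`, the letter `a`, and letters `bᵢ`. -/
inductive KGen : Type
  | vert : ℕ → List ℤ → KGen
  | a : KGen
  | b : ℤ → KGen
  deriving DecidableEq

/-- The parent `(n,τ)⁻` of a vertex `(n,τ)` of the tree `T`. -/
def parent : ℕ → List ℤ → ℕ × List ℤ
  | n, [] => (n + 1, [])
  | n, τ => (n, τ.dropLast)

/-- Words over an alphabet `α` (a letter together with `true` for the letter itself,
`false` for its formal inverse). -/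
abbrev Word (α : Type) := List (α × Bool)

/-- The word `u(x,y) = x y x² y x³ y ⋯ x¹⁰⁰ y`. -/
def uWord {α : Type} (x y : α) : Word α :=
  (List.range 100).flatMap fun k => List.replicate (k + 1) (x, true) ++ [(y, true)]

/-- The relator words of the presentation of `K`:
`u((n,τ),a) ((n,τ)⁻)⁻¹` and `u((n,τ),bᵢ) ((n,τ⌢⟨i⟩))⁻¹`. -/
def KRelWords : Set (Word KGen) :=
  { w | (∃ (n : ℕ) (τ : List ℤ), w = uWord (KGen.vert n τ) KGen.a ++ [(KGen.vert (parent n τ).1 (parent n τ).2, false)]) ∨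
        (∃ (n : ℕ) (τ : List ℤ) (i : ℤ), w = uWord (KGen.vert n τ) (KGen.b i) ++ [(KGen.vert n (τ ++ [i]), false)]) }

/-- The relators of `K` as elements of the free group. -/
def KRels : Set (FreeGroup KGen) := FreeGroup.mk '' KRelWords

/-- The group `K`. -/
abbrev K := PresentedGroup KRels

/-- Generators of `G`: the generators of `K` together with the stable letter `t = none`. -/
abbrev GGen := Option KGen

/-- The relator words of the presentation of `G = ⟨K, t ∣ t bᵢ t⁻¹ = b_{i+1}⟩`:
the relators of `K` together with `t bᵢ t⁻¹ b_{i+1}⁻¹`. -/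
def GRelWords : Set (Word GGen) :=
  (fun w : Word KGen => w.map fun p => (some p.1, p.2)) '' KRelWords ∪
    { w | ∃ i : ℤ, w = [((none : GGen), true), (some (KGen.b i), true), ((none : GGen), false),
        (some (KGen.b (i + 1)), false)] }

/-- The relators of `G` as elements of the free group. -/
def GRels : Set (FreeGroup GGen) := FreeGroup.mk '' GRelWords

/-- The group `G`, the HNN extension of `K` along `bᵢ ↦ b_{i+1}`. -/
abbrev G := PresentedGroup GRels

/-- The vertex `(n,τ)` as an element of `G`. -/
def gvert (n : ℕ) (τ : List ℤ) : G := PresentedGroup.of (some (KGen.vert n τ))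

/-- `a` as an element of `G`. -/
def ga : G := PresentedGroup.of (some KGen.a)

/-- `bᵢ` as an element of `G`. -/
def gb (i : ℤ) : G := PresentedGroup.of (some (KGen.b i))

/-- The stable letter `t` as an element of `G`. -/
def gt' : G := PresentedGroup.of (none : GGen)

/-- The subgroup `H` of `G` generated by `(1,⟨⟩)`, `a`, `b₀` and `t`. -/
def H : Subgroup G := Subgroup.closure {gvert 1 [], ga, gb 0, gt'}

/-- Evaluating `u(x,y)` in a group: the prefix of the product consisting of `n` blocks. -/
def uProd {M : Type*} [Monoid M] (s y : M) (n : ℕ) : M :=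
  ((List.range n).map fun k => s ^ (k + 1) * y).prod

theorem uProd_succ {M : Type*} [Monoid M] (s y : M) (n : ℕ) :
    uProd s y (n + 1) = uProd s y n * (s ^ (n + 1) * y) := by
  simp [uProd, List.range_succ]

theorem lift_mk_uWord {α : Type} {M : Type*} [Group M] (f : α → M) (x y : α) :
    FreeGroup.lift f (FreeGroup.mk (uWord x y)) = uProd (f x) (f y) 100 := by
  simp only [FreeGroup.lift_mk, uWord, uProd]
  induction List.range 100 with
  | nil => simp
  | cons k l ih => simp_all [mul_assoc]

/-- If `s⁶ = y² = 1`, then `u(s,y)` is controlled by `w = s y s² y s³ y s⁴ y s⁵`. -/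
theorem uProd_eq_of_sq_eq_one {M : Type*} [Group M] {s y w : M} (hs : s ^ 6 = 1) (hy : y * y = 1)
    (hw : s * y * s ^ 2 * y * s ^ 3 * y * s ^ 4 * y * s ^ 5 = w) (hw2 : w ^ 2 = 1) :
    uProd s y 100 = w * s := by
  have hpow (j i : ℕ) : s ^ (6 * j + i) = s ^ i := by simp [pow_add, pow_mul, hs]
  have hblock (j : ℕ) : uProd s y (6 * j) = w ^ j := by
    induction j with
    | zero => simp [uProd]
    | succ j ih =>
      have h6 : s ^ (6 * j + 5 + 1) = 1 := by rw [add_assoc, hpow, hs]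
      rw [show 6 * (j + 1) = 6 * j + 5 + 1 by ring, uProd_succ, uProd_succ, uProd_succ, uProd_succ,
        uProd_succ, uProd_succ, ih, h6]
      simp only [add_assoc, Nat.reduceAdd, hpow]
      rw [pow_succ w, ← hw]
      simp only [mul_assoc, one_mul, hy, mul_one, pow_one]
  have h96 : uProd s y 96 = 1 := by
    rw [show 96 = 6 * 16 by norm_num, hblock, show 16 = 2 * 8 by norm_num, pow_mul, hw2, one_pow]
  have h4 (i : ℕ) : s ^ (96 + i) = s ^ i := hpow 16 i
  have h97 : s ^ 97 = s := by simpa using h4 1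
  have h98 : s ^ 98 = s ^ 2 := h4 2
  have h99 : s ^ 99 = s ^ 3 := h4 3
  have h100 : s ^ 100 = s ^ 4 := h4 4
  rw [show 100 = 96 + 3 + 1 by norm_num, uProd_succ, uProd_succ, uProd_succ, uProd_succ, h96]
  simp only [Nat.reduceAdd, h97, h98, h99, h100, ← hw]
  simp only [mul_assoc, one_mul, ← pow_succ, hs, mul_one]

/-- Bi-infinite binary sequences. -/
abbrev BinSeq := ℤ → ZMod 2

/-- The space on which `G` acts by affine maps. -/
@[ext] structure AffSpace where
  n : BinSeq
  x : BinSeq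
  z : BinSeq
  p : BinSeq
  q : BinSeq
  r : BinSeq

/-- The linear map `δₘ ↦ δₘ + δₘ₋₁` on sequences supported on `ℕ`, with `δ₋₁` read as `0`. -/
def boundary : BinSeq →+ BinSeq where
  toFun f i := if 0 ≤ i then f i + f (i + 1) else 0
  map_zero' := by ext; simp
  map_add' f g := by ext i; simp only [Pi.add_apply]; split_ifs <;> ring

theorem BinSeq.add_self (f : BinSeq) : f + f = 0 := CharTwo.add_self_eq_zero f

theorem BinSeq.add_add_cancel (f g : BinSeq) : f + (f + g) = g := by
  rw [← add_assoc, BinSeq.add_self, zero_add]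

/-- The affine map whose linear part has order three and whose translation part is `f` in the
coordinate `x`. -/
def rot (f : BinSeq) : Equiv.Perm AffSpace where
  toFun v := ⟨v.n + boundary v.x, f + (v.x + v.z), v.x, v.q, v.r, v.p⟩
  invFun v := ⟨v.n + boundary v.z, v.z, f + (v.x + v.z), v.r, v.p, v.q⟩
  left_inv v := by
    ext1 <;> simp only [add_comm, add_left_comm, BinSeq.add_add_cancel, BinSeq.add_self, add_zero]
  right_inv v := by
    ext1 <;> simp only [add_comm, add_left_comm, BinSeq.add_add_cancel, BinSeq.add_self, add_zero]

/-- The linear involution exchanging `n` with `p`, and `z` with `q` up to a twist by `T`. -/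
def flipPerm (T : BinSeq ≃+ BinSeq) : Equiv.Perm AffSpace where
  toFun v := ⟨v.p, v.x, T v.q, v.n, T.symm v.z, v.r⟩
  invFun v := ⟨v.p, v.x, T v.q, v.n, T.symm v.z, v.r⟩
  left_inv v := by simp
  right_inv v := by simp

/-- Translation in the coordinate `x`. -/
def transl (f : BinSeq) : Equiv.Perm AffSpace where
  toFun v := ⟨v.n, f + v.x, v.z, v.p, v.q, v.r⟩
  invFun v := ⟨v.n, f + v.x, v.z, v.p, v.q, v.r⟩
  left_inv v := by simp only [BinSeq.add_add_cancel]
  right_inv v := by simp only [BinSeq.add_add_cancel]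

theorem rot_sq_apply (f : BinSeq) (v : AffSpace) :
    (rot f ^ 2) v = ⟨v.n + (boundary f + boundary v.z), v.z, f + (v.x + v.z), v.r, v.p, v.q⟩ := by
  rw [pow_two, Equiv.Perm.mul_apply]
  ext1 <;> simp [rot, add_comm, add_left_comm, BinSeq.add_add_cancel]

theorem rot_cube_apply (f : BinSeq) (v : AffSpace) :
    (rot f ^ 3) v = ⟨v.n + boundary f, v.x, v.z, v.p, v.q, v.r⟩ := by
  rw [pow_succ', Equiv.Perm.mul_apply, rot_sq_apply]
  ext1 <;> simp [rot, add_comm, add_left_comm, BinSeq.add_add_cancel, BinSeq.add_self]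

theorem uProd_rot_flipPerm (f : BinSeq) (T : BinSeq ≃+ BinSeq) :
    uProd (rot f) (flipPerm T) 100 = rot (f + T (boundary f)) := by
  have hs : rot f ^ 6 = 1 := by
    ext1 v
    rw [show 6 = 3 + 3 by norm_num, pow_add, Equiv.Perm.mul_apply]
    simp only [rot_cube_apply, add_assoc, BinSeq.add_self, add_zero, Equiv.Perm.one_apply]
  have hw : rot f * flipPerm T * rot f ^ 2 * flipPerm T * rot f ^ 3 * flipPerm T * rot f ^ 4 *
      flipPerm T * rot f ^ 5 = transl (T (boundary f)) := by
    ext1 v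
    rw [show 5 = 3 + 2 by norm_num, show 4 = 3 + 1 by norm_num, pow_add, pow_add, pow_one]
    simp only [Equiv.Perm.mul_apply, rot_cube_apply, rot_sq_apply]
    ext1 <;> simp [rot, flipPerm, transl, add_comm, add_left_comm, BinSeq.add_add_cancel,
      BinSeq.add_self]
  have hw2 : transl (T (boundary f)) ^ 2 = 1 := by
    ext1 v
    simp only [pow_two, Equiv.Perm.mul_apply, Equiv.Perm.one_apply]
    exact (transl _).left_inv v
  have hy : flipPerm T * flipPerm T = 1 := Equiv.ext fun v => (flipPerm T).left_inv v
  rw [uProd_eq_of_sq_eq_one hs hy hw hw2]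
  ext1 v
  simp [transl, rot, add_left_comm, add_assoc]

/-- The shift of sequences, `δₘ ↦ δₘ₊₁`. -/
def shift : BinSeq ≃+ BinSeq where
  toFun f i := f (i - 1)
  invFun f i := f (i + 1)
  left_inv f := by simp
  right_inv f := by simp
  map_add' f g := rfl

/-- The translation part of the vertex `(n,τ)`: the indicator of `[0, |τ|]` if `n = 0`, and zero
otherwise. -/
def vertSeq : ℕ → List ℤ → BinSeq
  | 0, τ => fun i => if 0 ≤ i ∧ i ≤ τ.length then 1 else 0
  | _ + 1, _ => 0

theorem boundary_vertSeq_zero (τ : List ℤ) :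
    boundary (vertSeq 0 τ) = Pi.single (τ.length : ℤ) 1 := by
  ext i
  simp only [boundary, vertSeq, AddMonoidHom.coe_mk, ZeroHom.coe_mk, Pi.single_apply]
  split_ifs <;> first | omega | decide

theorem vertSeq_add_boundary (n : ℕ) (τ : List ℤ) :
    vertSeq n τ + boundary (vertSeq n τ) = vertSeq (parent n τ).1 (parent n τ).2 := by
  match n, τ with
  | n + 1, [] => simp [vertSeq, parent]
  | n + 1, i :: τ => simp [vertSeq, parent]
  | 0, [] =>
    rw [boundary_vertSeq_zero]
    ext i
    simp only [vertSeq, parent, Pi.add_apply, Pi.single_apply, List.length_nil, Pi.zero_apply]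
    split_ifs <;> first | omega | decide
  | 0, j :: τ =>
    rw [boundary_vertSeq_zero]
    ext i
    simp only [vertSeq, parent, Pi.add_apply, Pi.single_apply, List.length_dropLast,
      List.length_cons]
    split_ifs <;> first | omega | decide

theorem vertSeq_add_shift_boundary (n : ℕ) (τ : List ℤ) (j : ℤ) :
    vertSeq n τ + shift (boundary (vertSeq n τ)) = vertSeq n (τ ++ [j]) := by
  cases n with
  | succ n => simp [vertSeq]
  | zero =>
    rw [boundary_vertSeq_zero]
    ext i
    simp only [vertSeq, shift, AddEquiv.coe_mk, Equiv.coe_fn_mk, Pi.add_apply, Pi.single_apply,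
      List.length_append, List.length_singleton]
    split_ifs <;> first | omega | decide

/-- The affine maps by which the generators of `G` act. -/
def genPerm : GGen → Equiv.Perm AffSpace
  | none => 1
  | some (KGen.vert n τ) => rot (vertSeq n τ)
  | some KGen.a => flipPerm (AddEquiv.refl _)
  | some (KGen.b _) => flipPerm shift

theorem lift_some_mk {M : Type*} [Group M] (f : GGen → M) (w : Word KGen) :
    FreeGroup.lift f (FreeGroup.mk (w.map fun p => (some p.1, p.2))) =
      FreeGroup.lift (fun k => f (some k)) (FreeGroup.mk w) := by
  simp only [FreeGroup.lift_mk, List.map_map]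
  rfl

theorem lift_genPerm_eq_one : ∀ r ∈ GRels, FreeGroup.lift genPerm r = 1 := by
  rintro _ ⟨w, ⟨w, ⟨n, τ, rfl⟩ | ⟨n, τ, i, rfl⟩, rfl⟩ | ⟨i, rfl⟩, rfl⟩
  · rw [lift_some_mk, ← FreeGroup.mul_mk, map_mul, lift_mk_uWord]
    simp only [genPerm, uProd_rot_flipPerm, AddEquiv.refl_apply, vertSeq_add_boundary]
    simp
  · rw [lift_some_mk, ← FreeGroup.mul_mk, map_mul, lift_mk_uWord]
    simp only [genPerm, uProd_rot_flipPerm, vertSeq_add_shift_boundary n τ i]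
    simp
  · simp [genPerm]

/-- The affine action of `G`. -/
def affAction : G →* Equiv.Perm AffSpace := PresentedGroup.toGroup lift_genPerm_eq_one

/-- The origin of the affine space. -/
def origin : AffSpace := ⟨0, 0, 0, 0, 0, 0⟩

theorem H_le_stabilizer :
    H ≤ (MulAction.stabilizer (Equiv.Perm AffSpace) origin).comap affAction := by
  rw [H, Subgroup.closure_le]
  rintro g (rfl | rfl | rfl | rfl) <;>
    simp [affAction, gvert, ga, gb, gt', genPerm, MulAction.mem_stabilizer_iff, rot, flipPerm, origin,
      vertSeq]

/-- The element `(0,⟨⟩)` of `G` does not belong to `H`; in particular `H` is proper. -/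
theorem stmt7 : gvert 0 [] ∉ H ∧ H ≠ ⊤ := by
  have key : gvert 0 [] ∉ H := by
    intro h
    have h0 := H_le_stabilizer h
    simp only [affAction, gvert, Subgroup.mem_comap, PresentedGroup.toGroup.of, genPerm,
      MulAction.mem_stabilizer_iff, Equiv.Perm.smul_def] at h0
    have h1 := congrFun (congrArg AffSpace.x h0) 0
    simp [rot, origin, vertSeq] at h1
  exact ⟨key, fun h => key (h ▸ Subgroup.mem_top _)⟩
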